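/- arXiv:2306.15157 — 12 statements merged into one kernel-verified Lean document; each statement's English description precedes it below -/
import Mathlib

section
/- Let p₁ be a tropical polynomial function on ℝⁿ with representation p₁(x) = max_{i=1..m} (aᵢ·x + bᵢ). Then for every x ∈ ℝⁿ, p₁(x) = sup_{a ∈ ℝⁿ} (a·x + ENF_{p₁}(a)), where the supremum is taken in the extended reals and equals the finite value p₁(x). -/
open scoped BigOperators

/-- The extended Newton function of a tropical polynomial with coefficient
vectors `a i` and constants `b i`: `ENF a b c = sup { t : (c,t) ∈ ENewt(p) }`,
valued in the extended reals (so `sup ∅ = ⊥ = -∞`). -/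
noncomputable def ENF {n m : ℕ} (a : Fin m → Fin n → ℝ) (b : Fin m → ℝ)
    (c : Fin n → ℝ) : EReal :=
  sSup (Real.toEReal ''
    {t : ℝ | (c, t) ∈ convexHull ℝ (Set.range fun i => ((a i, b i) : (Fin n → ℝ) × ℝ))})

/-- On the extended Newton polytope, the affine functional `(c, t) ↦ c·x + t` is bounded by any
upper bound of its values at the generators. -/
theorem dotProduct_add_le_of_mem_convexHull {ι : Type*} {n : ℕ} {a : ι → Fin n → ℝ}
    {b : ι → ℝ} {x : Fin n → ℝ} {M : ℝ} (hM : ∀ i, (∑ j, a i j * x j) + b i ≤ M)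
    {c : Fin n → ℝ} {t : ℝ}
    (h : (c, t) ∈ convexHull ℝ (Set.range fun i => ((a i, b i) : (Fin n → ℝ) × ℝ))) :
    (∑ j, c j * x j) + t ≤ M := by
  let f : (Fin n → ℝ) × ℝ →ₗ[ℝ] ℝ :=
    (∑ j, x j • (LinearMap.proj j : (Fin n → ℝ) →ₗ[ℝ] ℝ)).comp (LinearMap.fst ℝ _ _) +
      LinearMap.snd ℝ _ _
  have hf (q : (Fin n → ℝ) × ℝ) : f q = (∑ j, q.1 j * x j) + q.2 := by
    simp [f, mul_comm]
  have hsub : convexHull ℝ (Set.range fun i => ((a i, b i) : (Fin n → ℝ) × ℝ)) ⊆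
      {q | f q ≤ M} := by
    refine convexHull_min ?_ (convex_halfSpace_le f.isLinear M)
    rintro _ ⟨i, rfl⟩
    simpa [hf] using hM i
  simpa [hf] using hsub h

theorem le_ENF {n m : ℕ} (a : Fin m → Fin n → ℝ) (b : Fin m → ℝ) (i : Fin m) :
    (b i : EReal) ≤ ENF a b (a i) :=
  le_sSup ⟨b i, subset_convexHull ℝ _ ⟨i, rfl⟩, rfl⟩

theorem coe_add_ENF_le {n m : ℕ} {a : Fin m → Fin n → ℝ} {b : Fin m → ℝ} {x : Fin n → ℝ}
    {M : ℝ} (hM : ∀ i, (∑ j, a i j * x j) + b i ≤ M) (c : Fin n → ℝ) :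
    ((∑ j, c j * x j : ℝ) : EReal) + ENF a b c ≤ M := by
  have h : ENF a b c ≤ ((M - ∑ j, c j * x j : ℝ) : EReal) := by
    refine sSup_le ?_
    rintro _ ⟨t, ht, rfl⟩
    have := dotProduct_add_le_of_mem_convexHull hM ht
    exact EReal.coe_le_coe_iff.2 (by linarith)
  calc ((∑ j, c j * x j : ℝ) : EReal) + ENF a b c
      ≤ ((∑ j, c j * x j : ℝ) : EReal) + ((M - ∑ j, c j * x j : ℝ) : EReal) := by gcongr
    _ = M := by rw [← EReal.coe_add, add_sub_cancel]

/-- For a tropical polynomial function `p(x) = max_i (aᵢ·x + bᵢ)`, one has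
`p(x) = sup_{c ∈ ℝⁿ} (c·x + ENF_p(c))` in the extended reals. -/
theorem stmt0 {n m : ℕ} (a : Fin (m + 1) → Fin n → ℝ) (b : Fin (m + 1) → ℝ)
    (p : (Fin n → ℝ) → ℝ)
    (hp : ∀ x, p x = ⨆ i, ((∑ j, a i j * x j) + b i)) (x : Fin n → ℝ) :
    (p x : EReal) = ⨆ c : Fin n → ℝ, (((∑ j, c j * x j : ℝ) : EReal) + ENF a b c) := by
  refine le_antisymm ?_ (iSup_le fun c => coe_add_ENF_le (fun i => ?_) c)
  · obtain ⟨i, hi⟩ := exists_eq_ciSup_of_finite (f := fun i => (∑ j, a i j * x j) + b i)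
    refine le_iSup_of_le (a i) ?_
    rw [hp x, ← hi, EReal.coe_add]
    gcongr
    exact le_ENF a b i
  · rw [hp x]
    exact le_ciSup (f := fun i => (∑ j, a i j * x j) + b i) (Set.finite_range _).bddAbove i
end

section
/- Let p₁ and p₂ be tropical polynomial functions on ℝⁿ. Then p₁(x) ≤ p₂(x) for all x ∈ ℝⁿ if and only if ENF_{p₁}(a) ≤ ENF_{p₂}(a) for all a ∈ ℝⁿ. -/
open scoped BigOperators

/-- Every point `(c, t)` of the extended Newton polytope satisfies `c·x + t ≤ p(x)`. -/
theorem dot_add_le_iSup_of_mem_convexHull {n m : ℕ} {a : Fin m → Fin n → ℝ} {b : Fin m → ℝ}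
    {c : Fin n → ℝ} {t : ℝ}
    (h : (c, t) ∈ convexHull ℝ (Set.range fun i => ((a i, b i) : (Fin n → ℝ) × ℝ)))
    (x : Fin n → ℝ) :
    (∑ j, c j * x j) + t ≤ ⨆ i, ((∑ j, a i j * x j) + b i) := by
  set M := ⨆ i, ((∑ j, a i j * x j) + b i)
  have hlin : IsLinearMap ℝ fun q : (Fin n → ℝ) × ℝ => (∑ j, q.1 j * x j) + q.2 := by
    constructor
    · intro q r
      simp only [Prod.fst_add, Prod.snd_add, Pi.add_apply, add_mul, Finset.sum_add_distrib]
      ring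
    · intro k q
      simp [mul_add, Finset.mul_sum, mul_assoc]
  refine convexHull_min (t := {q : (Fin n → ℝ) × ℝ | (∑ j, q.1 j * x j) + q.2 ≤ M}) ?_
    (convex_halfSpace_le hlin M) h
  rintro _ ⟨i, rfl⟩
  exact le_ciSup (f := fun i => (∑ j, a i j * x j) + b i) (Set.finite_range _).bddAbove i

/-- A continuous linear functional on `ℝⁿ × ℝ` in coordinates. -/
theorem clm_pi_prod_apply {n : ℕ} (f : ((Fin n → ℝ) × ℝ) →L[ℝ] ℝ) (v : Fin n → ℝ) (r : ℝ) :
    f (v, r) = (∑ j, v j * f (Pi.single j 1, 0)) + r * f (0, 1) := by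
  have h₁ : f (v, 0) = ∑ j, v j * f (Pi.single j 1, 0) := by
    have hsingle : ∀ j : Fin n, (Pi.single j 1 : Fin n → ℝ) = fun i => if j = i then 1 else 0 :=
      fun j => funext fun i => by simp [Pi.single_apply, eq_comm]
    simpa [hsingle] using LinearMap.pi_apply_eq_sum_univ
      ((f : ((Fin n → ℝ) × ℝ) →ₗ[ℝ] ℝ) ∘ₗ LinearMap.inl ℝ (Fin n → ℝ) ℝ) v
  have h₂ : f (0, r) = r * f (0, 1) := by
    rw [← smul_eq_mul, ← map_smul]
    simp
  rw [← h₁, ← h₂, ← map_add]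
  simp

/-- If the affine function `c·x + t` lies below the tropical polynomial everywhere, then the
extended Newton polytope contains a point above `(c, t)`. -/
theorem exists_le_mem_convexHull {n m : ℕ} {a : Fin (m + 1) → Fin n → ℝ} {b : Fin (m + 1) → ℝ}
    {c : Fin n → ℝ} {t : ℝ}
    (h : ∀ x : Fin n → ℝ, (∑ j, c j * x j) + t ≤ ⨆ i, ((∑ j, a i j * x j) + b i)) :
    ∃ s, t ≤ s ∧ (c, s) ∈ convexHull ℝ (Set.range fun i => ((a i, b i) : (Fin n → ℝ) × ℝ)) := by
  set K := convexHull ℝ (Set.range fun i => ((a i, b i) : (Fin n → ℝ) × ℝ))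
  have hKc : IsCompact K := (Set.finite_range _).isCompact_convexHull ℝ
  let R : Set ((Fin n → ℝ) × ℝ) := {c} ×ˢ Set.Ici t
  have hRconv : Convex ℝ R := (convex_singleton c).prod (convex_Ici t)
  have hRclosed : IsClosed R := isClosed_singleton.prod isClosed_Ici
  by_contra! hne
  have hdisj : Disjoint K R := by
    rw [Set.disjoint_left]
    rintro ⟨v, s⟩ hs ⟨hv, hts⟩
    obtain rfl : v = c := hv
    exact hne s hts hs
  obtain ⟨f, u, w, hu, huw, hw⟩ :=
    geometric_hahn_banach_compact_closed (convex_convexHull ℝ _) hKc hRconv hRclosed hdisj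
  set y : Fin n → ℝ := fun j => f (Pi.single j 1, 0)
  set k := f (0, 1)
  have hlow : ∀ i, (∑ j, a i j * y j) + b i * k < u := fun i => by
    have := hu (a i, b i) (subset_convexHull ℝ _ ⟨i, rfl⟩)
    rwa [clm_pi_prod_apply] at this
  have hup : ∀ s, t ≤ s → w < (∑ j, c j * y j) + s * k := fun s hs => by
    have := hw (c, s) ⟨rfl, hs⟩
    rwa [clm_pi_prod_apply] at this
  have hk0 : 0 ≤ k := by
    by_contra! hneg
    set D := (∑ j, c j * y j) + t * k - w
    have hD : 0 < D := by have := hup t le_rfl; simp only [D]; linarith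
    have h₁ := hup (t + D / (-k)) (by have := div_pos hD (neg_pos.2 hneg); linarith)
    have h₂ : D / (-k) * k = -D := by
      rw [div_neg, neg_mul, div_mul_cancel₀ _ hneg.ne]
    simp only [add_mul, h₂, D] at h₁
    linarith
  -- A non-vertical separating hyperplane yields a point where `c·x + t` exceeds `p`.
  have key : ∀ l : ℝ, 0 < l →
      ¬ ∀ i, (∑ j, a i j * y j) + b i * l < (∑ j, c j * y j) + t * l := by
    intro l hl hlt
    have hx := h fun j => y j / l
    obtain ⟨i, hi⟩ :=
      exists_eq_ciSup_of_finite (f := fun i => (∑ j, a i j * (y j / l)) + b i)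
    rw [← hi] at hx
    simp only [← mul_div_assoc, ← Finset.sum_div] at hx
    have h₁ := hlt i
    rw [← not_le] at h₁
    apply h₁
    have h₂ := mul_le_mul_of_nonneg_right hx hl.le
    simpa only [add_mul, div_mul_cancel₀ _ hl.ne'] using h₂
  have hupt := hup t le_rfl
  obtain ⟨B, hB⟩ := (Set.finite_range fun i => b i - t).bddAbove
  set l := (w - u) / (|B| + 1)
  have hB1 : 0 < |B| + 1 := by positivity
  have hlpos : 0 < l := div_pos (sub_pos.2 huw) hB1
  refine key (k + l) (by linarith) fun i => ?_
  have hbi : b i - t ≤ |B| + 1 := by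
    have := hB ⟨i, rfl⟩
    have := le_abs_self B
    simp only at *
    linarith
  have h₁ : (b i - t) * l ≤ w - u := by
    calc (b i - t) * l ≤ (|B| + 1) * l := mul_le_mul_of_nonneg_right hbi hlpos.le
      _ = w - u := mul_div_cancel₀ _ hB1.ne'
  have := hlow i
  linarith

/-- For tropical polynomial functions `p₁, p₂`, one has `p₁ ≤ p₂` pointwise iff
`ENF_{p₁} ≤ ENF_{p₂}` pointwise. -/
theorem stmt1 {n m₁ m₂ : ℕ}
    (a₁ : Fin (m₁ + 1) → Fin n → ℝ) (b₁ : Fin (m₁ + 1) → ℝ)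
    (a₂ : Fin (m₂ + 1) → Fin n → ℝ) (b₂ : Fin (m₂ + 1) → ℝ)
    (p₁ p₂ : (Fin n → ℝ) → ℝ)
    (hp₁ : ∀ x, p₁ x = ⨆ i, ((∑ j, a₁ i j * x j) + b₁ i))
    (hp₂ : ∀ x, p₂ x = ⨆ i, ((∑ j, a₂ i j * x j) + b₂ i)) :
    (∀ x, p₁ x ≤ p₂ x) ↔ (∀ c, ENF a₁ b₁ c ≤ ENF a₂ b₂ c) := by
  constructor
  · intro h c
    refine sSup_le ?_
    rintro _ ⟨t, ht, rfl⟩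
    obtain ⟨s, hts, hs⟩ := exists_le_mem_convexHull (a := a₂) (b := b₂) (c := c) (t := t) fun x =>
      calc (∑ j, c j * x j) + t ≤ p₁ x := hp₁ x ▸ dot_add_le_iSup_of_mem_convexHull ht x
        _ ≤ p₂ x := h x
        _ = _ := hp₂ x
    exact (EReal.coe_le_coe_iff.2 hts).trans (le_sSup ⟨s, hs, rfl⟩)
  · intro h x
    rw [hp₁]
    refine ciSup_le fun i => ?_
    have h₁ : (b₁ i : EReal) ≤ ENF a₁ b₁ (a₁ i) :=
      le_sSup ⟨b₁ i, subset_convexHull ℝ _ ⟨i, rfl⟩, rfl⟩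
    have h₂ : ENF a₂ b₂ (a₁ i) ≤ ((p₂ x - ∑ j, a₁ i j * x j : ℝ) : EReal) := by
      refine sSup_le ?_
      rintro _ ⟨t, ht, rfl⟩
      have := dot_add_le_iSup_of_mem_convexHull ht x
      rw [← hp₂] at this
      exact EReal.coe_le_coe_iff.2 (by linarith)
    have := EReal.coe_le_coe_iff.1 ((h₁.trans (h _)).trans h₂)
    linarith
end

section
/- Let p and d be tropical polynomial functions on ℝⁿ, set f = p − d, and define q(x) = sup_{a ∈ ℝⁿ} (a·x − f*(a)) (the convex biconjugate f** of f, valued in ℝ ∪ {±∞}), where f*(a) = sup_x (a·x − f(x)). Then (i) d(x) + q(x) ≤ p(x) for every x with q(x) finite, and (ii) for every tropical polynomial function q̃ with d(x) + q̃(x) ≤ p(x) for all x ∈ ℝⁿ, one has q̃(x) ≤ q(x) for all x ∈ ℝⁿ; consequently q coincides pointwise with Q(p,d)(x) = sup{ a·x + b : a ∈ ℝⁿ, b ∈ ℝ, d(y) + a·y + b ≤ p(y) for all y }. -/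
open scoped BigOperators

/-- `p : ℝⁿ → ℝ` is a tropical polynomial function if it is a finite max of
affine functions. -/
def IsTropPoly {n : ℕ} (p : (Fin n → ℝ) → ℝ) : Prop :=
  ∃ (m : ℕ) (a : Fin (m + 1) → Fin n → ℝ) (b : Fin (m + 1) → ℝ),
    ∀ x, p x = ⨆ i, ((∑ j, a i j * x j) + b i)

/-- The quotient function of the tropical division of `p` by `d`:
`Q(p,d)(x) = sup { a·x + b : d(y) + a·y + b ≤ p(y) for all y }`,
valued in the extended reals (so `sup ∅ = ⊥ = -∞`). -/
noncomputable def Qdiv {n : ℕ} (p d : (Fin n → ℝ) → ℝ) (x : Fin n → ℝ) : EReal :=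
  sSup (Real.toEReal ''
    {v : ℝ | ∃ (a : Fin n → ℝ) (b : ℝ), v = (∑ j, a j * x j) + b ∧
      ∀ y, d y + ((∑ j, a j * y j) + b) ≤ p y})

/-- The conjugate `f*(a)` is at most `-b` iff `a·y + b` is an affine minorant of `f`. -/
theorem iSup_affine_sub_le_coe_neg_iff {n : ℕ} (f : (Fin n → ℝ) → ℝ) (a : Fin n → ℝ) (b : ℝ) :
    (⨆ x : Fin n → ℝ, (((∑ j, a j * x j) - f x : ℝ) : EReal)) ≤ ((-b : ℝ) : EReal) ↔
      ∀ y, (∑ j, a j * y j) + b ≤ f y := by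
  simp only [iSup_le_iff, EReal.coe_le_coe_iff]
  exact forall_congr' fun y => by constructor <;> intro h <;> linarith

/-- Let `f = p - d`, `f*` its convex conjugate and `q = f**` its biconjugate
(valued in extended reals).  Then (i) `d(x) + q(x) ≤ p(x)` whenever `q(x)` is
finite, (ii) `q` dominates every tropical polynomial `q̃` with `d + q̃ ≤ p`,
and (iii) `q` coincides pointwise with the quotient function `Q(p,d)`. -/
theorem stmt2 {n : ℕ} (p d : (Fin n → ℝ) → ℝ)
    (hp : IsTropPoly p) (hd : IsTropPoly d)
    (f : (Fin n → ℝ) → ℝ) (hf : ∀ x, f x = p x - d x)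
    (fstar : (Fin n → ℝ) → EReal)
    (hfstar : ∀ a, fstar a = ⨆ x : Fin n → ℝ, (((∑ j, a j * x j) - f x : ℝ) : EReal))
    (q : (Fin n → ℝ) → EReal)
    (hq : ∀ x, q x = ⨆ a : Fin n → ℝ, ((((∑ j, a j * x j) : ℝ) : EReal) - fstar a)) :
    (∀ x, ∀ v : ℝ, q x = (v : EReal) → d x + v ≤ p x) ∧
    (∀ q' : (Fin n → ℝ) → ℝ, IsTropPoly q' → (∀ x, d x + q' x ≤ p x) →
      ∀ x, (q' x : EReal) ≤ q x) ∧
    (∀ x, q x = Qdiv p d x) := by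
  have feas : ∀ (a : Fin n → ℝ) (b : ℝ), fstar a ≤ ((-b : ℝ) : EReal) ↔
      ∀ y, d y + ((∑ j, a j * y j) + b) ≤ p y := by
    intro a b
    rw [hfstar, iSup_affine_sub_le_coe_neg_iff]
    refine forall_congr' fun y => ?_
    rw [hf]
    constructor <;> intro h <;> linarith
  have le_q : ∀ (a : Fin n → ℝ) (b : ℝ), (∀ y, d y + ((∑ j, a j * y j) + b) ≤ p y) → ∀ x,
      (((∑ j, a j * x j) + b : ℝ) : EReal) ≤ q x := by
    intro a b h x
    rw [hq]
    refine le_iSup_of_le a ?_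
    calc (((∑ j, a j * x j) + b : ℝ) : EReal)
        = ((∑ j, a j * x j : ℝ) : EReal) - ((-b : ℝ) : EReal) := by
          rw [← EReal.coe_sub, sub_neg_eq_add]
      _ ≤ _ := EReal.sub_le_sub le_rfl ((feas a b).2 h)
  have q_eq : ∀ x, q x = Qdiv p d x := by
    intro x
    apply le_antisymm
    · rw [hq]
      refine iSup_le fun a => ?_
      have hbot : fstar a ≠ ⊥ := by
        rw [hfstar]
        exact ((EReal.bot_lt_coe _).trans_le (le_iSup
          (fun x : Fin n → ℝ => (((∑ j, a j * x j) - f x : ℝ) : EReal)) 0)).ne'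
      by_cases htop : fstar a = ⊤
      · simp [htop]
      · lift fstar a to ℝ using ⟨htop, hbot⟩ with r hr
        refine le_sSup ⟨_, ⟨a, -r, rfl, (feas a (-r)).1 ?_⟩, ?_⟩
        · rw [neg_neg, hr]
        · rw [← EReal.coe_sub, sub_eq_add_neg]
    · refine sSup_le ?_
      rintro _ ⟨_, ⟨a, b, rfl, h⟩, rfl⟩
      exact le_q a b h x
  refine ⟨fun x v hv => ?_, fun q' hq' h x => ?_, q_eq⟩
  · have hle : (v : EReal) ≤ ((p x - d x : ℝ) : EReal) := by
      rw [← hv, q_eq]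
      refine sSup_le ?_
      rintro _ ⟨_, ⟨a, b, rfl, h⟩, rfl⟩
      exact EReal.coe_le_coe_iff.2 (by linarith [h x])
    linarith [EReal.coe_le_coe_iff.1 hle]
  · obtain ⟨m, a, b, hab⟩ := hq'
    obtain ⟨i, hi⟩ := exists_eq_ciSup_of_finite (f := fun i => (∑ j, a i j * x j) + b i)
    rw [hab, ← hi]
    refine le_q _ _ (fun y => ?_) x
    have hy : (∑ j, a i j * y j) + b i ≤ q' y := by
      rw [hab]
      exact le_ciSup (f := fun i => (∑ j, a i j * y j) + b i) (Set.finite_range _).bddAbove i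
    linarith [h y]
end

section
/- Let p and d be tropical polynomial functions on ℝⁿ and suppose there exist a ∈ ℝⁿ and b ∈ ℝ with d(x) + a·x + b ≤ p(x) for all x ∈ ℝⁿ. Then the quotient function Q(p,d) is itself a tropical polynomial function: there exist finitely many vectors â₁,…,â_L ∈ ℝⁿ and scalars b̂₁,…,b̂_L ∈ ℝ such that Q(p,d)(x) = max_{l=1..L} (â_l·x + b̂_l) for all x ∈ ℝⁿ. -/
open scoped BigOperators

/-- A polyhedral set is the solution set of finitely many (non-strict) linear inequalities. -/
def IsPolyhedral {E : Type*} [AddCommGroup E] [Module ℝ E] (S : Set E) : Prop :=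
  ∃ T : Set ((E →ₗ[ℝ] ℝ) × ℝ), T.Finite ∧ S = {z | ∀ g ∈ T, g.1 z ≤ g.2}

namespace IsPolyhedral

section Algebra

variable {E : Type*} [AddCommGroup E] [Module ℝ E]

theorem setOf_le {f : E → ℝ} (hf : IsLinearMap ℝ f) (c : ℝ) : IsPolyhedral {z | f z ≤ c} :=
  ⟨{(hf.mk' f, c)}, Set.finite_singleton _, by simp⟩

theorem setOf_and {P Q : E → Prop} (hP : IsPolyhedral {z | P z}) (hQ : IsPolyhedral {z | Q z}) :
    IsPolyhedral {z | P z ∧ Q z} := by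
  obtain ⟨S, hS, hPS⟩ := hP
  obtain ⟨T, hT, hQT⟩ := hQ
  refine ⟨S ∪ T, hS.union hT, ?_⟩
  ext z
  have h₁ := Set.ext_iff.1 hPS z
  have h₂ := Set.ext_iff.1 hQT z
  simp only [Set.mem_ofPred_eq] at h₁ h₂
  simp only [Set.mem_ofPred_eq, h₁, h₂, Set.mem_union, or_imp, forall_and]

theorem setOf_forall {ι : Type*} [Finite ι] {P : ι → E → Prop}
    (hP : ∀ i, IsPolyhedral {z | P i z}) : IsPolyhedral {z | ∀ i, P i z} := by
  choose T hT hPT using hP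
  refine ⟨⋃ i, T i, Set.finite_iUnion hT, ?_⟩
  ext z
  have h := fun i => Set.ext_iff.1 (hPT i) z
  simp only [Set.mem_ofPred_eq] at h
  simp only [Set.mem_ofPred_eq, h, Set.mem_iUnion, forall_exists_index]
  exact forall_comm

theorem setOf_eq {f : E → ℝ} (hf : IsLinearMap ℝ f) (c : ℝ) : IsPolyhedral {z | f z = c} := by
  have h : IsLinearMap ℝ (fun z => -f z) :=
    ⟨fun x y => by rw [hf.map_add]; ring, fun t x => by rw [hf.map_smul]; simp⟩
  convert setOf_and (setOf_le hf c) (setOf_le h (-c)) using 2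
  ext z
  rw [neg_le_neg_iff, le_antisymm_iff]

theorem convex {S : Set E} (hS : IsPolyhedral S) : Convex ℝ S := by
  obtain ⟨T, -, rfl⟩ := hS
  simp only [Set.ofPred_forall]
  exact convex_iInter fun g => convex_iInter fun _ => convex_halfSpace_le g.1.isLinear g.2

/-- An extreme point of a polyhedral set is determined by the inequalities which are tight at it,
so there are only finitely many of them. -/
theorem finite_extremePoints {S : Set E} (hS : IsPolyhedral S) :
    (S.extremePoints ℝ).Finite := by
  obtain ⟨T, hT, rfl⟩ := hS
  refine Set.Finite.of_injOn (f := fun z => {g ∈ T | g.1 z = g.2}) (t := 𝒫 T)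
    (fun z _ g hg => hg.1) ?_ hT.finite_subsets
  intro x hx x' _ hxx'
  have key : ∀ᶠ t : ℝ in nhdsWithin 0 (Set.Ioi 0), ∀ g ∈ T,
      g.1 (x + t • (x - x')) ≤ g.2 ∧ g.1 (x - t • (x - x')) ≤ g.2 := by
    rw [hT.eventually_all]
    intro g hg
    simp only [map_add, map_sub, map_smul, smul_eq_mul]
    rcases (hx.1 g hg).lt_or_eq with hlt | heq
    · refine Filter.Eventually.filter_mono nhdsWithin_le_nhds ?_
      have h₁ : Filter.Tendsto (fun t : ℝ => g.1 x + t * (g.1 x - g.1 x')) (nhds 0)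
          (nhds (g.1 x + 0 * (g.1 x - g.1 x'))) :=
        (Continuous.tendsto (by fun_prop) 0)
      have h₂ : Filter.Tendsto (fun t : ℝ => g.1 x - t * (g.1 x - g.1 x')) (nhds 0)
          (nhds (g.1 x - 0 * (g.1 x - g.1 x'))) :=
        (Continuous.tendsto (by fun_prop) 0)
      filter_upwards [h₁.eventually_lt_const (by simpa using hlt),
        h₂.eventually_lt_const (by simpa using hlt)] with t ht₁ ht₂
      exact ⟨ht₁.le, ht₂.le⟩
    · have h' : g.1 x' = g.2 := ((Set.ext_iff.1 hxx' g).1 ⟨hg, heq⟩).2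
      exact Filter.Eventually.of_forall fun t => by rw [heq, h']; simp
  obtain ⟨t, ht, ht₀⟩ := (key.and self_mem_nhdsWithin).exists
  have hseg : x ∈ openSegment ℝ (x + t • (x - x')) (x - t • (x - x')) :=
    ⟨1 / 2, 1 / 2, by norm_num, by norm_num, by norm_num, by module⟩
  have h := hx.2 (fun g hg => (ht g hg).1) (fun g hg => (ht g hg).2) hseg
  have h₀ : t • (x - x') = 0 := by simpa using h
  exact sub_eq_zero.1 ((smul_eq_zero.1 h₀).resolve_left (ne_of_gt ht₀))

end Algebra

theorem isClosed {E : Type*} [NormedAddCommGroup E] [NormedSpace ℝ E] [FiniteDimensional ℝ E]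
    {S : Set E} (hS : IsPolyhedral S) : IsClosed S := by
  obtain ⟨T, -, rfl⟩ := hS
  simp only [Set.ofPred_forall]
  exact isClosed_iInter fun g => isClosed_iInter fun _ =>
    isClosed_le g.1.continuous_of_finiteDimensional continuous_const

end IsPolyhedral

/-- A linear functional on a compact set is dominated at each point by its value at some extreme
point. -/
theorem IsCompact.exists_extremePoint_le {E : Type*} [NormedAddCommGroup E] [NormedSpace ℝ E]
    {S : Set E} (hS : IsCompact S) (f : StrongDual ℝ E) {z : E} (hz : z ∈ S) :
    ∃ e ∈ S.extremePoints ℝ, f z ≤ f e := by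
  have hexp : IsExposed ℝ S (f.toExposed S) := ContinuousLinearMap.toExposed.isExposed
  obtain ⟨m, hm, hmax⟩ := hS.exists_isMaxOn ⟨z, hz⟩ f.continuous.continuousOn
  obtain ⟨e, he⟩ := (hexp.isCompact hS).extremePoints_nonempty ⟨m, hm, hmax⟩
  exact ⟨e, hexp.isExtreme.extremePoints_subset_extremePoints he, he.1.2 z hz⟩

theorem sum_mul_le_of_mem_stdSimplex {ι : Type*} [Fintype ι] {w v : ι → ℝ} {c : ℝ}
    (hw : w ∈ stdSimplex ℝ ι) (h : ∀ i, v i ≤ c) : ∑ i, w i * v i ≤ c :=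
  calc ∑ i, w i * v i ≤ ∑ i, w i * c :=
        Finset.sum_le_sum fun i _ => mul_le_mul_of_nonneg_left (h i) (hw.1 i)
    _ = c := by rw [← Finset.sum_mul, hw.2, one_mul]

theorem le_sum_mul_of_mem_stdSimplex {ι : Type*} [Fintype ι] {w v : ι → ℝ} {c : ℝ}
    (hw : w ∈ stdSimplex ℝ ι) (h : ∀ i, c ≤ v i) : c ≤ ∑ i, w i * v i :=
  calc c = ∑ i, w i * c := by rw [← Finset.sum_mul, hw.2, one_mul]
    _ ≤ ∑ i, w i * v i :=
        Finset.sum_le_sum fun i _ => mul_le_mul_of_nonneg_left (h i) (hw.1 i)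

/-- Affine form of Farkas' lemma: an affine function lies below a finite maximum of affine
functions iff it lies below a convex combination of them with the same linear part. -/
theorem affine_le_iSup_iff {n : ℕ} {ι : Type*} [Fintype ι] [Nonempty ι]
    (A : ι → Fin n → ℝ) (B : ι → ℝ) (a : Fin n → ℝ) (b : ℝ) :
    (∀ y : Fin n → ℝ, (∑ j, a j * y j) + b ≤ ⨆ i, ((∑ j, A i j * y j) + B i)) ↔
      ∃ w ∈ stdSimplex ℝ ι, (∀ j, ∑ i, w i * A i j = a j) ∧ b ≤ ∑ i, w i * B i := by
  constructor
  · intro h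
    by_contra hcon
    let F : (ι → ℝ) → (Fin n → ℝ) × ℝ := fun w => (fun j => ∑ i, w i * A i j, ∑ i, w i * B i)
    have hF : IsLinearMap ℝ F := by
      constructor
      · intro x y
        ext <;> simp [F, add_mul, Finset.sum_add_distrib]
      · intro c x
        ext <;> simp [F, mul_assoc, Finset.mul_sum]
    have hFc : Continuous F := by fun_prop
    have hray : Convex ℝ (({a} : Set (Fin n → ℝ)) ×ˢ Set.Ici b) :=
      (convex_singleton a).prod (convex_Ici b)
    obtain ⟨f, u, v, hu, huv, hv⟩ := geometric_hahn_banach_compact_closed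
      ((convex_stdSimplex ℝ ι).is_linear_image hF) ((isCompact_stdSimplex ℝ ι).image hFc)
      hray (isClosed_singleton.prod isClosed_Ici) (by
        rw [Set.disjoint_left]
        rintro _ ⟨w, hw, rfl⟩ ⟨h₁, h₂⟩
        exact hcon ⟨w, hw, fun j => congrFun h₁ j, h₂⟩)
    let y : Fin n → ℝ := fun j => f (Pi.single j 1, 0)
    let s : ℝ := f (0, 1)
    have hf : ∀ (c : Fin n → ℝ) (t : ℝ), f (c, t) = (∑ j, c j * y j) + t * s := by
      intro c t
      have h₁ : f (c, t) = f (c, 0) + t * f (0, 1) := by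
        rw [← smul_eq_mul, ← map_smul, ← map_add]
        simp
      have h₂ := LinearMap.pi_apply_eq_sum_univ
        (f.toLinearMap ∘ₗ LinearMap.inl ℝ (Fin n → ℝ) ℝ) c
      rw [h₁]
      congr 1
      refine h₂.trans (Finset.sum_congr rfl fun j _ => ?_)
      simp only [y, smul_eq_mul, LinearMap.comp_apply, LinearMap.inl_apply]
      have h₃ : (fun k => if j = k then (1 : ℝ) else 0) = Pi.single j 1 := by
        ext k
        simp [Pi.single_apply, eq_comm]
      rw [h₃]
      rfl
    have hs : 0 ≤ s := by
      by_contra! hs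
      obtain ⟨t, ht⟩ := exists_nat_gt ((v - f (a, b)) / s)
      have h₁ := hv (a, b + t) ⟨rfl, by simp⟩
      rw [div_lt_iff_of_neg hs] at ht
      rw [hf] at h₁ ht
      linarith
    have hlt : ∀ i, (∑ j, A i j * y j) + B i * s < (∑ j, a j * y j) + b * s := by
      intro i
      classical
      have h₁ := hu _ ⟨_, single_mem_stdSimplex ℝ i, rfl⟩
      have h₂ := hv (a, b) ⟨rfl, Set.self_mem_Ici⟩
      have h₃ : F (Pi.single i 1) = (A i, B i) := by
        ext <;> simp [F, Pi.single_apply]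
      rw [h₃] at h₁
      rw [hf] at h₁ h₂
      linarith
    have hev : ∀ᶠ ε : ℝ in nhdsWithin 0 (Set.Ioi 0), ∀ i,
        (∑ j, A i j * y j) + B i * (s + ε) < (∑ j, a j * y j) + b * (s + ε) := by
      rw [Filter.eventually_all]
      intro i
      refine Filter.Eventually.filter_mono nhdsWithin_le_nhds ?_
      refine ContinuousAt.eventually_lt (by fun_prop) (by fun_prop) ?_
      simpa using hlt i
    obtain ⟨ε, hε, hε₀⟩ := (hev.and self_mem_nhdsWithin).exists
    have hpos : 0 < s + ε := add_pos_of_nonneg_of_pos hs hε₀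
    obtain ⟨i, hi⟩ := exists_eq_ciSup_of_finite
      (f := fun i => (∑ j, A i j * (y j / (s + ε))) + B i)
    have h₁ := h fun j => y j / (s + ε)
    rw [← hi] at h₁
    simp only [← mul_div_assoc, ← Finset.sum_div] at h₁
    have h₂ := mul_le_mul_of_nonneg_right h₁ hpos.le
    rw [add_mul, add_mul, div_mul_cancel₀ _ hpos.ne', div_mul_cancel₀ _ hpos.ne'] at h₂
    exact (hε i).not_ge h₂
  · rintro ⟨w, hw, ha, hb⟩ y
    calc (∑ j, a j * y j) + b ≤ (∑ j, a j * y j) + ∑ i, w i * B i := by gcongr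
      _ = ∑ i, w i * ((∑ j, A i j * y j) + B i) := by
          simp only [mul_add, Finset.sum_add_distrib, ← ha, Finset.sum_mul, Finset.mul_sum]
          rw [Finset.sum_comm]
          simp only [mul_assoc]
      _ ≤ _ := sum_mul_le_of_mem_stdSimplex hw fun i =>
          le_ciSup (f := fun i => (∑ j, A i j * y j) + B i) (Set.finite_range _).bddAbove i

/-- The affine functions whose sum with one finite maximum of affine functions lies below another
such maximum are dominated, at every point, by finitely many of them. -/
theorem exists_finite_dominating {n : ℕ} {ι κ : Type*} [Fintype ι] [Nonempty ι]
    [Fintype κ] [Nonempty κ] (A : ι → Fin n → ℝ) (B : ι → ℝ) (C : κ → Fin n → ℝ) (e : κ → ℝ) :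
    ∃ G : Set ((Fin n → ℝ) × ℝ), G.Finite ∧
      (∀ q ∈ G, ∀ k, ∃ w ∈ stdSimplex ℝ ι,
        (∀ j, ∑ i, w i * A i j = q.1 j + C k j) ∧ q.2 + e k ≤ ∑ i, w i * B i) ∧
      ∀ q : (Fin n → ℝ) × ℝ, (∀ k, ∃ w ∈ stdSimplex ℝ ι,
        (∀ j, ∑ i, w i * A i j = q.1 j + C k j) ∧ q.2 + e k ≤ ∑ i, w i * B i) →
        ∀ x : Fin n → ℝ, ∃ g ∈ G, (∑ j, q.1 j * x j) + q.2 ≤ (∑ j, g.1 j * x j) + g.2 := by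
  obtain ⟨β, hβ⟩ := (Set.finite_range fun r : ι × κ => B r.1 - e r.2).bddBelow
  obtain ⟨U, hU⟩ := (Set.finite_range fun r : ι × κ => B r.1 - e r.2).bddAbove
  replace hβ : ∀ i k, β ≤ B i - e k := fun i k => hβ ⟨(i, k), rfl⟩
  replace hU : ∀ i k, B i - e k ≤ U := fun i k => hU ⟨(i, k), rfl⟩
  obtain ⟨k₀⟩ := ‹Nonempty κ›
  let K : Set ((κ → ι → ℝ) × ℝ) := {z | (∀ k, (∀ i, -z.1 k i ≤ 0) ∧ ∑ i, z.1 k i = 1) ∧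
    (∀ k j, ∑ i, z.1 k i * A i j - ∑ i, z.1 k₀ i * A i j = C k j - C k₀ j) ∧
    (∀ k, z.2 - ∑ i, z.1 k i * B i ≤ -e k) ∧ -z.2 ≤ -β}
  have hsimp : ∀ z ∈ K, ∀ k, z.1 k ∈ stdSimplex ℝ ι := fun z hz k =>
    ⟨fun i => neg_nonpos.1 ((hz.1 k).1 i), (hz.1 k).2⟩
  have hKpoly : IsPolyhedral K := by
    refine .setOf_and (.setOf_forall fun k => .setOf_and
      (.setOf_forall fun i => .setOf_le ⟨?_, ?_⟩ _) (.setOf_eq ⟨?_, ?_⟩ _))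
      (.setOf_and (.setOf_forall fun k => .setOf_forall fun j => .setOf_eq ⟨?_, ?_⟩ _)
      (.setOf_and (.setOf_forall fun k => .setOf_le ⟨?_, ?_⟩ _) (.setOf_le ⟨?_, ?_⟩ _))) <;>
    intros <;>
    simp [add_mul, Finset.sum_add_distrib, mul_assoc, ← Finset.mul_sum] <;> ring
  have hKcomp : IsCompact K := by
    refine (isCompact_Icc (a := ((0 : κ → ι → ℝ), β)) (b := ((1 : κ → ι → ℝ), U))).of_isClosed_subset
      hKpoly.isClosed fun z hz => ⟨⟨fun k i => (hsimp z hz k).1 i, neg_le_neg_iff.1 hz.2.2.2⟩,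
        fun k i => ?_, ?_⟩
    · change z.1 k i ≤ 1
      rw [← (hsimp z hz k).2]
      exact Finset.single_le_sum (fun i _ => (hsimp z hz k).1 i) (Finset.mem_univ i)
    · have h₁ := hz.2.2.1 k₀
      have h₂ : ∑ i, z.1 k₀ i * B i ≤ U + e k₀ :=
        sum_mul_le_of_mem_stdSimplex (hsimp z hz k₀) fun i => by linarith [hU i k₀]
      change z.2 ≤ U
      linarith
  let Φ : (κ → ι → ℝ) × ℝ → (Fin n → ℝ) × ℝ :=
    fun z => (fun j => ∑ i, z.1 k₀ i * A i j - C k₀ j, z.2)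
  refine ⟨Φ '' K.extremePoints ℝ, hKpoly.finite_extremePoints.image Φ, ?_, ?_⟩
  · rintro _ ⟨z, hz, rfl⟩ k
    refine ⟨z.1 k, hsimp z hz.1 k, fun j => ?_, ?_⟩
    · have := hz.1.2.1 k j
      simp only [Φ]
      linarith
    · have := hz.1.2.2.1 k
      simp only [Φ]
      linarith
  · intro q hq x
    choose w hw hwA hwB using hq
    have hz : (w, max q.2 β) ∈ K := by
      refine ⟨fun k => ⟨fun i => neg_nonpos.2 ((hw k).1 i), (hw k).2⟩, fun k j => ?_,
        fun k => ?_, neg_le_neg (le_max_right _ _)⟩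
      · simp only [hwA]
        ring
      · have h₁ : β + e k ≤ ∑ i, w k i * B i :=
          le_sum_mul_of_mem_stdSimplex (hw k) fun i => by linarith [hβ i k]
        have h₂ : max q.2 β ≤ ∑ i, w k i * B i - e k :=
          max_le (by linarith [hwB k]) (by linarith)
        change max q.2 β - ∑ i, w k i * B i ≤ -e k
        linarith
    have hlin : IsLinearMap ℝ fun z : (κ → ι → ℝ) × ℝ =>
        (∑ j, (∑ i, z.1 k₀ i * A i j) * x j) + z.2 := by
      constructor
      · intro z z'
        simp [add_mul, Finset.sum_add_distrib]
        ring
      · intro c z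
        simp [mul_assoc, ← Finset.mul_sum, mul_add]
    obtain ⟨z, hzK, hle⟩ := hKcomp.exists_extremePoint_le
      (LinearMap.toContinuousLinearMap (hlin.mk' _)) hz
    refine ⟨Φ z, ⟨z, hzK, rfl⟩, ?_⟩
    simp only [LinearMap.coe_toContinuousLinearMap', IsLinearMap.mk'_apply, hwA, add_mul,
      Finset.sum_add_distrib] at hle
    simp only [Φ, sub_mul, Finset.sum_sub_distrib]
    linarith [le_max_left q.2 β]

/-- If the division of `p` by `d` is nontrivial (some affine minorant exists),
then the quotient function `Q(p,d)` is itself a tropical polynomial function. -/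
theorem stmt3 {n : ℕ} (p d : (Fin n → ℝ) → ℝ)
    (hp : IsTropPoly p) (hd : IsTropPoly d)
    (hnt : ∃ (a : Fin n → ℝ) (b : ℝ), ∀ x, d x + ((∑ j, a j * x j) + b) ≤ p x) :
    ∃ (L : ℕ) (ahat : Fin (L + 1) → Fin n → ℝ) (bhat : Fin (L + 1) → ℝ),
      ∀ x, Qdiv p d x = ((⨆ l, ((∑ j, ahat l j * x j) + bhat l) : ℝ) : EReal) := by
  obtain ⟨mp, A, B, hp⟩ := hp
  obtain ⟨md, C, e, hd⟩ := hd
  have hfeas : ∀ (a : Fin n → ℝ) (b : ℝ), (∀ y, d y + ((∑ j, a j * y j) + b) ≤ p y) ↔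
      ∀ k, ∃ w ∈ stdSimplex ℝ (Fin (mp + 1)),
        (∀ j, ∑ i, w i * A i j = a j + C k j) ∧ b + e k ≤ ∑ i, w i * B i := by
    intro a b
    have h₁ := fun k => affine_le_iSup_iff A B (fun j => a j + C k j) (b + e k)
    simp only [← h₁, ← hp, add_mul, Finset.sum_add_distrib]
    rw [forall_comm]
    refine forall_congr' fun y => ?_
    rw [← le_sub_iff_add_le, hd, ciSup_le_iff (Set.finite_range _).bddAbove]
    refine forall_congr' fun k => ?_
    rw [le_sub_iff_add_le]
    ring_nf
  obtain ⟨G, hGfin, hG, hdom⟩ := exists_finite_dominating A B C e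
  obtain ⟨a₀, b₀, h₀⟩ := hnt
  obtain ⟨g₀, hg₀, -⟩ := hdom (a₀, b₀) ((hfeas a₀ b₀).1 h₀) 0
  have : Finite G := hGfin
  have : Nonempty G := ⟨⟨g₀, hg₀⟩⟩
  obtain ⟨N, ⟨φ⟩⟩ := Finite.exists_equiv_fin G
  obtain ⟨L, rfl⟩ : ∃ L, N = L + 1 :=
    Nat.exists_eq_succ_of_ne_zero fun h => by subst h; exact (φ ⟨g₀, hg₀⟩).elim0
  refine ⟨L, fun l => (φ.symm l).1.1, fun l => (φ.symm l).1.2, fun x => le_antisymm ?_ ?_⟩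
  · refine sSup_le ?_
    rintro _ ⟨_, ⟨a, b, rfl, h⟩, rfl⟩
    obtain ⟨g, hg, hle⟩ := hdom (a, b) ((hfeas a b).1 h) x
    refine EReal.coe_le_coe_iff.2 (hle.trans ?_)
    have h₁ := le_ciSup (f := fun l => (∑ j, (φ.symm l).1.1 j * x j) + (φ.symm l).1.2)
      (Set.finite_range _).bddAbove (φ ⟨g, hg⟩)
    simpa only [Equiv.symm_apply_apply] using h₁
  · obtain ⟨l, hl⟩ := exists_eq_ciSup_of_finite
      (f := fun l => (∑ j, (φ.symm l).1.1 j * x j) + (φ.symm l).1.2)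
    rw [← hl]
    exact le_sSup ⟨_, ⟨_, _, rfl, (hfeas _ _).2 (hG _ (φ.symm l).2)⟩, rfl⟩
end

section
/- Let p(x) = max_{i=1..m} (aᵢ·x + bᵢ) and d be tropical polynomial functions on ℝⁿ, and let q be a tropical polynomial function that is the quotient of the division of p by d (i.e., d + q ≤ p pointwise and q dominates every tropical polynomial q̃ with d + q̃ ≤ p). Let I = { i : ∃ x ∈ ℝⁿ with p(x) > d(x) + q(x) and p(x) = aᵢ·x + bᵢ }, and define r(x) = max_{i ∈ I} (aᵢ·x + bᵢ) (with r ≡ −∞ if I = ∅). Then p(x) = max( d(x) + q(x), r(x) ) for all x ∈ ℝⁿ, and every tropical polynomial function r̃ satisfying p(x) = max( d(x) + q(x), r̃(x) ) for all x satisfies r(x) ≤ r̃(x) for all x ∈ ℝⁿ. -/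
open scoped BigOperators

theorem IsTropPoly.continuous {n : ℕ} {p : (Fin n → ℝ) → ℝ} (hp : IsTropPoly p) :
    Continuous p := by
  obtain ⟨m, a, b, h⟩ := hp
  have hsup : p = fun x => Finset.univ.sup' Finset.univ_nonempty
      fun i => (∑ j, a i j * x j) + b i := by
    funext x
    rw [h x, Finset.sup'_univ_eq_ciSup]
  rw [hsup]
  exact Continuous.finset_sup'_apply _ fun i _ => by fun_prop

theorem IsTropPoly.convexOn {n : ℕ} {p : (Fin n → ℝ) → ℝ} (hp : IsTropPoly p) :
    ConvexOn ℝ Set.univ p := by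
  obtain ⟨m, a, b, h⟩ := hp
  refine ⟨convex_univ, fun x _ y _ s t hs ht hst => ?_⟩
  rw [h (s • x + t • y)]
  refine ciSup_le fun i => ?_
  have hle : ∀ z, (∑ j, a i j * z j) + b i ≤ p z := fun z => by
    rw [h z]
    exact le_ciSup (f := fun i => (∑ j, a i j * z j) + b i) (Set.finite_range _).bddAbove i
  have hsum : ∑ j, a i j * (s • x + t • y) j
      = s * (∑ j, a i j * x j) + t * ∑ j, a i j * y j := by
    rw [Finset.mul_sum, Finset.mul_sum, ← Finset.sum_add_distrib]
    refine Finset.sum_congr rfl fun j _ => ?_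
    simp only [Pi.add_apply, Pi.smul_apply, smul_eq_mul]
    ring
  calc (∑ j, a i j * (s • x + t • y) j) + b i
      = s * ((∑ j, a i j * x j) + b i) + t * ((∑ j, a i j * y j) + b i) := by
        rw [hsum]
        linear_combination -(b i) * hst
    _ ≤ s * p x + t * p y :=
        add_le_add (mul_le_mul_of_nonneg_left (hle x) hs) (mul_le_mul_of_nonneg_left (hle y) ht)

/-- An affine function that touches a tropical polynomial from below near a point lies below it
everywhere. -/
theorem IsTropPoly.affine_le_of_eventually_le {n : ℕ} {p : (Fin n → ℝ) → ℝ} (hp : IsTropPoly p)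
    (c : Fin n → ℝ) (e : ℝ) {x₀ : Fin n → ℝ} (heq : p x₀ = (∑ j, c j * x₀ j) + e)
    (hle : ∀ᶠ x in nhds x₀, (∑ j, c j * x j) + e ≤ p x) (x : Fin n → ℝ) :
    (∑ j, c j * x j) + e ≤ p x := by
  have hneg : IsTropPoly fun x : Fin n → ℝ => (∑ j, -c j * x j) + -e :=
    ⟨0, fun _ => -c, fun _ => -e, fun x => by simp⟩
  have hmin : IsLocalMin (p + fun x : Fin n → ℝ => (∑ j, -c j * x j) + -e) x₀ := by
    filter_upwards [hle] with x hx
    simp only [Pi.add_apply, neg_mul, Finset.sum_neg_distrib]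
    linarith
  have hx := IsMinOn.of_isLocalMin_of_convex_univ hmin (hp.convexOn.add hneg.convexOn) x
  simp only [Pi.add_apply, neg_mul, Finset.sum_neg_distrib] at hx
  linarith

/-- Let `q` be the quotient of the division of `p = max_i (aᵢ·x+bᵢ)` by `d`, let
`I` be the set of indices of terms of `p` that exceed `d + q` somewhere where
they attain the max, and `r(x) = max_{i ∈ I} (aᵢ·x+bᵢ)` (equal to `-∞` if
`I = ∅`).  Then `p = max(d + q, r)` pointwise, and `r` is minimal among tropical
polynomials `r̃` with `p = max(d + q, r̃)` pointwise. -/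
theorem stmt4 {n m : ℕ} (a : Fin (m + 1) → Fin n → ℝ) (b : Fin (m + 1) → ℝ)
    (p d q : (Fin n → ℝ) → ℝ)
    (hp : ∀ x, p x = ⨆ i, ((∑ j, a i j * x j) + b i))
    (hd : IsTropPoly d) (hq : IsTropPoly q)
    (hq1 : ∀ x, d x + q x ≤ p x)
    (hq2 : ∀ q' : (Fin n → ℝ) → ℝ, IsTropPoly q' → (∀ x, d x + q' x ≤ p x) →
      ∀ x, q' x ≤ q x)
    (I : Set (Fin (m + 1)))
    (hI : I = {i | ∃ x, d x + q x < p x ∧ p x = (∑ j, a i j * x j) + b i})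
    (r : (Fin n → ℝ) → EReal)
    (hr : ∀ x, r x = sSup (Real.toEReal ''
      ((fun i => (∑ j, a i j * x j) + b i) '' I))) :
    (∀ x, (p x : EReal) = max ((d x + q x : ℝ) : EReal) (r x)) ∧
    (∀ r' : (Fin n → ℝ) → ℝ, IsTropPoly r' →
      (∀ x, p x = max (d x + q x) (r' x)) → ∀ x, r x ≤ (r' x : EReal)) := by
  have hle : ∀ i x, (∑ j, a i j * x j) + b i ≤ p x := fun i x => by
    rw [hp x]
    exact le_ciSup (f := fun i => (∑ j, a i j * x j) + b i) (Set.finite_range _).bddAbove i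
  constructor
  · intro x
    apply le_antisymm
    · rcases (hq1 x).lt_or_eq with hlt | heq
      · obtain ⟨i, hi⟩ := exists_eq_ciSup_of_finite (f := fun i => (∑ j, a i j * x j) + b i)
        have hpi : p x = (∑ j, a i j * x j) + b i := (hp x).trans hi.symm
        refine le_max_of_le_right ?_
        rw [hr x, hpi]
        refine le_sSup (Set.mem_image_of_mem _ (Set.mem_image_of_mem _ ?_))
        rw [hI]
        exact ⟨x, hlt, hpi⟩
      · rw [heq]
        exact le_max_left _ _
    · refine max_le (EReal.coe_le_coe_iff.2 (hq1 x)) ?_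
      rw [hr x]
      refine sSup_le ?_
      rintro _ ⟨_, ⟨i, _, rfl⟩, rfl⟩
      exact EReal.coe_le_coe_iff.2 (hle i x)
  · intro r' hr' hmax x
    rw [hr x]
    refine sSup_le ?_
    rintro _ ⟨_, ⟨i, hi, rfl⟩, rfl⟩
    rw [hI] at hi
    obtain ⟨x₀, hlt, heq⟩ := hi
    have hr'_eq : ∀ y, d y + q y < p y → r' y = p y := fun y hy => by
      have hy' := hmax y
      rcases max_choice (d y + q y) (r' y) with h | h <;> rw [h] at hy' <;> linarith
    have hp_cont : Continuous p := IsTropPoly.continuous ⟨m, a, b, hp⟩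
    have hev : ∀ᶠ y in nhds x₀, d y + q y < p y :=
      (hd.continuous.add hq.continuous).continuousAt.eventually_lt hp_cont.continuousAt hlt
    refine EReal.coe_le_coe_iff.2
      (hr'.affine_le_of_eventually_le (a i) (b i) ((hr'_eq x₀ hlt).trans heq) ?_ x)
    filter_upwards [hev] with y hy
    rw [hr'_eq y hy]
    exact hle i y
end

section
/- Let p and d be tropical polynomial functions on ℝⁿ, and let q, r be tropical polynomial functions which are respectively the quotient and remainder of the division of p by d. If q̄, r̄ are the quotient and remainder of the division of r by d, then r̄(x) = r(x) for all x ∈ ℝⁿ (i.e., the division of r by d is not effective). -/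
open scoped BigOperators

/-- `q` is the quotient of the tropical division of `p` by `d`: it is a
tropical polynomial with `d + q ≤ p` pointwise that dominates every tropical
polynomial `q̃` with `d + q̃ ≤ p`. -/
def IsQuotient {n : ℕ} (p d q : (Fin n → ℝ) → ℝ) : Prop :=
  IsTropPoly q ∧ (∀ x, d x + q x ≤ p x) ∧
    ∀ q' : (Fin n → ℝ) → ℝ, IsTropPoly q' → (∀ x, d x + q' x ≤ p x) →
      ∀ x, q' x ≤ q x

/-- `r` is the remainder of the tropical division of `p` by `d` with quotient
`q`: it is a tropical polynomial with `p = max (d + q) r` pointwise, minimal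
among tropical polynomials with this property. -/
def IsRemainder {n : ℕ} (p d q r : (Fin n → ℝ) → ℝ) : Prop :=
  IsTropPoly r ∧ (∀ x, p x = max (d x + q x) (r x)) ∧
    ∀ r' : (Fin n → ℝ) → ℝ, IsTropPoly r' →
      (∀ x, p x = max (d x + q x) (r' x)) → ∀ x, r x ≤ r' x

/-- If `q, r` are the quotient and remainder of the division of `p` by `d`,
and `q̄, r̄` are the quotient and remainder of the division of `r` by `d`,
then `r̄ = r` pointwise: the division of `r` by `d` is not effective. -/
theorem stmt5 {n : ℕ} (p d q r qbar rbar : (Fin n → ℝ) → ℝ)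
    (hp : IsTropPoly p) (hd : IsTropPoly d)
    (hq : IsQuotient p d q) (hr : IsRemainder p d q r)
    (hqbar : IsQuotient r d qbar) (hrbar : IsRemainder r d qbar rbar) :
    ∀ x, rbar x = r x := by
  have hqq : ∀ x, qbar x ≤ q x := by
    refine hq.2.2 qbar hqbar.1 fun x => (hqbar.2.1 x).trans ?_
    rw [hr.2.1 x]
    exact le_max_right _ _
  intro x
  refine le_antisymm ?_ (hr.2.2 rbar hrbar.1 (fun y => ?_) x)
  · rw [hrbar.2.1 x]
    exact le_max_right _ _
  · rw [hr.2.1 y, hrbar.2.1 y, ← max_assoc, max_eq_left (add_le_add_right (hqq y) (d y))]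
end

section
/- Let p(x) = max_{i=1..m_p} (aᵢ·x + bᵢ) and d(x) = max_{j=1..m_d} (ãⱼ·x + b̃ⱼ) be tropical polynomial functions on ℝⁿ, let C = { c ∈ ℝⁿ : c + ãⱼ ∈ conv{a₁,…,a_{m_p}} for all j = 1,…,m_d }, and let l(a) = inf_{x ∈ ℝⁿ} ( p(x) − d(x) − a·x ) ∈ ℝ ∪ {−∞}. Then C = { a ∈ ℝⁿ : l(a) > −∞ }. -/
open scoped BigOperators

/-- A linear functional takes at a point of the convex hull of finitely many vectors a value at most
its value at one of these vectors. -/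
theorem exists_dotProduct_le_of_mem_convexHull {ι κ : Type*} [Finite ι] [Nonempty ι] [Fintype κ]
    {a : ι → κ → ℝ} {v : κ → ℝ} (hv : v ∈ convexHull ℝ (Set.range a)) (x : κ → ℝ) :
    ∃ i, v ⬝ᵥ x ≤ a i ⬝ᵥ x := by
  obtain ⟨i, hi⟩ := Finite.exists_max fun i => a i ⬝ᵥ x
  have hconv : Convex ℝ {w : κ → ℝ | w ⬝ᵥ x ≤ a i ⬝ᵥ x} :=
    convex_halfSpace_le ⟨fun _ _ => add_dotProduct _ _ _, fun _ _ => smul_dotProduct _ _ _⟩ _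
  exact ⟨i, convexHull_min (Set.range_subset_iff.2 hi) hconv hv⟩

/-- A point outside the convex hull of finitely many vectors is strictly separated from them by a
dot product. -/
theorem exists_dotProduct_lt_of_notMem_convexHull {ι κ : Type*} [Finite ι] [Fintype κ]
    {a : ι → κ → ℝ} {v : κ → ℝ} (hv : v ∉ convexHull ℝ (Set.range a)) :
    ∃ (y : κ → ℝ) (u : ℝ), (∀ i, a i ⬝ᵥ y < u) ∧ u < v ⬝ᵥ y := by
  classical
  obtain ⟨f, u, hfu, huv⟩ := geometric_hahn_banach_closed_point (convex_convexHull ℝ _)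
    ((Set.finite_range a).isClosed_convexHull ℝ) hv
  have hf (w : κ → ℝ) : f w = w ⬝ᵥ fun k => f fun j => if k = j then 1 else 0 :=
    LinearMap.pi_apply_eq_sum_univ (f : (κ → ℝ) →ₗ[ℝ] ℝ) w
  refine ⟨fun k => f fun j => if k = j then 1 else 0, u, fun i => ?_, ?_⟩
  · rw [← hf]
    exact hfu _ (subset_convexHull ℝ _ ⟨i, rfl⟩)
  · rwa [← hf]

/-- Let `p(x) = max_i (aᵢ·x + bᵢ)` and `d(x) = max_j (ãⱼ·x + b̃ⱼ)`, let
`C = { c : c + ãⱼ ∈ conv{a₁,…,a_{m_p}} for all j }` and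
`l(a) = inf_x (p(x) - d(x) - a·x) ∈ ℝ ∪ {-∞}`.  Then `C` is exactly the set
where `l` is finite. -/
theorem stmt7 {n mp md : ℕ}
    (a : Fin (mp + 1) → Fin n → ℝ) (b : Fin (mp + 1) → ℝ)
    (ta : Fin (md + 1) → Fin n → ℝ) (tb : Fin (md + 1) → ℝ)
    (p d : (Fin n → ℝ) → ℝ)
    (hp : ∀ x, p x = ⨆ i, ((∑ j, a i j * x j) + b i))
    (hd : ∀ x, d x = ⨆ j, ((∑ k, ta j k * x k) + tb j))
    (C : Set (Fin n → ℝ))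
    (hC : C = {c | ∀ j, c + ta j ∈ convexHull ℝ (Set.range a)})
    (l : (Fin n → ℝ) → EReal)
    (hl : ∀ c, l c = ⨅ x : Fin n → ℝ, ((p x - d x - ∑ j, c j * x j : ℝ) : EReal)) :
    C = {c | ⊥ < l c} := by
  subst hC
  have hp_ge (x : Fin n → ℝ) (i) : a i ⬝ᵥ x + b i ≤ p x := by
    rw [hp]
    exact le_ciSup (f := fun i => a i ⬝ᵥ x + b i) (Set.finite_range _).bddAbove i
  have hd_ge (x : Fin n → ℝ) (j) : ta j ⬝ᵥ x + tb j ≤ d x := by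
    rw [hd]
    exact le_ciSup (f := fun j => ta j ⬝ᵥ x + tb j) (Set.finite_range _).bddAbove j
  ext c
  simp only [Set.mem_ofPred_eq]
  constructor
  · intro hc
    obtain ⟨i₀, hi₀⟩ := Finite.exists_min b
    obtain ⟨j₀, hj₀⟩ := Finite.exists_max tb
    refine (EReal.bot_lt_coe (b i₀ - tb j₀)).trans_le ?_
    rw [hl]
    refine le_iInf fun x => EReal.coe_le_coe_iff.2 ?_
    have hdx : d x ≤ p x - c ⬝ᵥ x - b i₀ + tb j₀ := by
      rw [hd]
      refine ciSup_le fun j => ?_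
      obtain ⟨i, hi⟩ := exists_dotProduct_le_of_mem_convexHull (hc j) x
      rw [add_dotProduct] at hi
      change ta j ⬝ᵥ x + tb j ≤ _
      linarith [hp_ge x i, hi₀ i, hj₀ j]
    change _ ≤ p x - d x - c ⬝ᵥ x
    linarith
  · intro hc j
    by_contra hj
    obtain ⟨y, u, hau, huv⟩ := exists_dotProduct_lt_of_notMem_convexHull hj
    obtain ⟨K, -, hK⟩ := EReal.lt_iff_exists_real_btwn.1 hc
    obtain ⟨i₀, hi₀⟩ := Finite.exists_max b
    rw [add_dotProduct] at huv
    obtain ⟨t, ht⟩ := exists_nat_gt ((b i₀ - tb j - K) / (c ⬝ᵥ y + ta j ⬝ᵥ y - u))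
    rw [div_lt_iff₀ (by linarith)] at ht
    have hpt : p ((t : ℝ) • y) ≤ t * u + b i₀ := by
      rw [hp]
      refine ciSup_le fun i => ?_
      change a i ⬝ᵥ ((t : ℝ) • y) + b i ≤ _
      rw [dotProduct_smul, smul_eq_mul]
      exact add_le_add (mul_le_mul_of_nonneg_left (hau i).le t.cast_nonneg) (hi₀ i)
    have hdt := hd_ge ((t : ℝ) • y) j
    rw [hl] at hK
    have hKt : K < p ((t : ℝ) • y) - d ((t : ℝ) • y) - c ⬝ᵥ ((t : ℝ) • y) :=
      EReal.coe_lt_coe_iff.1 (hK.trans_le (iInf_le _ ((t : ℝ) • y)))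
    rw [dotProduct_smul, smul_eq_mul] at hdt hKt
    linarith
end

section
/- Let p(x) = max_{i=1..m_p} (aᵢ·x + bᵢ) and d(x) = max_{j=1..m_d} (ãⱼ·x + b̃ⱼ) be tropical polynomial functions on ℝⁿ and let C = { c ∈ ℝⁿ : c + ãⱼ ∈ conv{a₁,…,a_{m_p}} for all j }. Then the division of p by d is nontrivial — i.e., there exist a ∈ ℝⁿ and b ∈ ℝ with d(x) + a·x + b ≤ p(x) for all x ∈ ℝⁿ — if and only if C ≠ ∅. -/
open scoped BigOperators

/-- An affine function whose slope lies in the Newton polytope of a tropical polynomial, and whose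
constant term is at most every coefficient, is bounded above by that polynomial. -/
lemma dotProduct_add_le_iSup_of_mem_convexHull {ι κ : Type*} [Finite ι] [Fintype κ]
    {a : ι → κ → ℝ} {b : ι → ℝ} {y : κ → ℝ} {m : ℝ} (hm : ∀ i, m ≤ b i)
    (hy : y ∈ convexHull ℝ (Set.range a)) (x : κ → ℝ) :
    y ⬝ᵥ x + m ≤ ⨆ i, (a i ⬝ᵥ x + b i) := by
  have hconv : Convex ℝ {z : κ → ℝ | z ⬝ᵥ x ≤ (⨆ i, (a i ⬝ᵥ x + b i)) - m} :=
    convex_halfSpace_le ⟨fun _ _ => add_dotProduct .., fun _ _ => smul_dotProduct ..⟩ _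
  have hsub : Set.range a ⊆ {z : κ → ℝ | z ⬝ᵥ x ≤ (⨆ i, (a i ⬝ᵥ x + b i)) - m} := by
    rintro _ ⟨i, rfl⟩
    have := le_ciSup (Set.finite_range fun i => a i ⬝ᵥ x + b i).bddAbove i
    simp only [Set.mem_ofPred_eq]
    linarith [hm i]
  have := convexHull_min hsub hconv hy
  simp only [Set.mem_ofPred_eq] at this
  linarith

/-- The slope of an affine function bounded above by a tropical polynomial lies in its Newton
polytope. -/
lemma mem_convexHull_of_forall_dotProduct_add_le_iSup {ι κ : Type*} [Finite ι] [Nonempty ι]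
    [Fintype κ] {a : ι → κ → ℝ} {b : ι → ℝ} {y : κ → ℝ} {v : ℝ}
    (h : ∀ x, y ⬝ᵥ x + v ≤ ⨆ i, (a i ⬝ᵥ x + b i)) :
    y ∈ convexHull ℝ (Set.range a) := by
  classical
  by_contra hy
  obtain ⟨f, u, hfu, huy⟩ := geometric_hahn_banach_closed_point (convex_convexHull ℝ (Set.range a))
    ((Set.finite_range a).isClosed_convexHull ℝ) hy
  obtain ⟨w, hw⟩ : ∃ w : κ → ℝ, ∀ z, z ⬝ᵥ w = f z :=
    ⟨fun k => f fun j => if k = j then 1 else 0, fun z =>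
      (LinearMap.pi_apply_eq_sum_univ f.toLinearMap z).symm⟩
  obtain ⟨B, hB⟩ := (Set.finite_range b).bddAbove
  obtain ⟨t, ht⟩ := exists_nat_gt ((B - v) / (f y - u))
  rw [div_lt_iff₀ (by linarith)] at ht
  have hle : ⨆ i, (a i ⬝ᵥ ((t : ℝ) • w) + b i) ≤ t * u + B := by
    refine ciSup_le fun i => ?_
    rw [dotProduct_smul, hw, smul_eq_mul]
    exact add_le_add (mul_le_mul_of_nonneg_left
      (hfu _ (subset_convexHull ℝ _ ⟨i, rfl⟩)).le t.cast_nonneg) (hB ⟨i, rfl⟩)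
  have hlow := h ((t : ℝ) • w)
  rw [dotProduct_smul, hw, smul_eq_mul] at hlow
  linarith

/-- The division of `p(x) = max_i (aᵢ·x + bᵢ)` by `d(x) = max_j (ãⱼ·x + b̃ⱼ)` is
nontrivial (some affine function `a·x + b` satisfies `d + (a·x+b) ≤ p`
everywhere) if and only if `C = { c : c + ãⱼ ∈ conv{a₁,…,a_{m_p}} ∀ j } ≠ ∅`. -/
theorem stmt8 {n mp md : ℕ}
    (a : Fin (mp + 1) → Fin n → ℝ) (b : Fin (mp + 1) → ℝ)
    (ta : Fin (md + 1) → Fin n → ℝ) (tb : Fin (md + 1) → ℝ)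
    (p d : (Fin n → ℝ) → ℝ)
    (hp : ∀ x, p x = ⨆ i, ((∑ j, a i j * x j) + b i))
    (hd : ∀ x, d x = ⨆ j, ((∑ k, ta j k * x k) + tb j))
    (C : Set (Fin n → ℝ))
    (hC : C = {c | ∀ j, c + ta j ∈ convexHull ℝ (Set.range a)}) :
    (∃ (c : Fin n → ℝ) (v : ℝ), ∀ x, d x + ((∑ j, c j * x j) + v) ≤ p x) ↔
      C.Nonempty := by
  subst hC
  change ∀ x, p x = ⨆ i, (a i ⬝ᵥ x + b i) at hp
  change ∀ x, d x = ⨆ j, (ta j ⬝ᵥ x + tb j) at hd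
  change (∃ (c : Fin n → ℝ) (v : ℝ), ∀ x, d x + (c ⬝ᵥ x + v) ≤ p x) ↔ _
  constructor
  · rintro ⟨c, v, h⟩
    refine ⟨c, fun j => mem_convexHull_of_forall_dotProduct_add_le_iSup (b := b)
      (v := tb j + v) fun x => ?_⟩
    have hj := le_ciSup (Set.finite_range fun j => ta j ⬝ᵥ x + tb j).bddAbove j
    have hx := h x
    rw [hd, hp] at hx
    rw [add_dotProduct]
    linarith
  · rintro ⟨c, hc⟩
    obtain ⟨m, hm⟩ := (Set.finite_range b).bddBelow
    obtain ⟨M, hM⟩ := (Set.finite_range tb).bddAbove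
    refine ⟨c, m - M, fun x => ?_⟩
    have hle : d x ≤ p x - (c ⬝ᵥ x + (m - M)) := by
      rw [hd]
      refine ciSup_le fun j => ?_
      have hj := dotProduct_add_le_iSup_of_mem_convexHull (fun i => hm ⟨i, rfl⟩) (hc j) x
      rw [add_dotProduct, ← hp] at hj
      linarith [hM ⟨j, rfl⟩]
    linarith
end

section
/- Let p(x) = max_{i=1..m_p} (aᵢ·x + bᵢ) and d(x) = max_{j=1..m_d} (ãⱼ·x + b̃ⱼ) be tropical polynomial functions on ℝⁿ and let C = { c ∈ ℝⁿ : c + ãⱼ ∈ conv{a₁,…,a_{m_p}} for all j }. If â ∈ ℝⁿ and b̂ ∈ ℝ satisfy â·x + b̂ + d(x) ≤ p(x) for all x ∈ ℝⁿ, then â ∈ C. In particular, every affine term â_i·x + b̂_i of a tropical polynomial quotient q of the division of p by d has â_i ∈ C. -/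
open scoped BigOperators

/-- If an affine function is bounded above by a finite maximum of affine functions, then its
slope lies in the convex hull of the slopes of that maximum. -/
theorem mem_convexHull_of_affine_le_iSup {n m : ℕ}
    (a : Fin (m + 1) → Fin n → ℝ) (b : Fin (m + 1) → ℝ) (v : Fin n → ℝ) (β : ℝ)
    (h : ∀ x : Fin n → ℝ, (∑ j, v j * x j) + β ≤ ⨆ i, ((∑ j, a i j * x j) + b i)) :
    v ∈ convexHull ℝ (Set.range a) := by
  by_contra hv
  obtain ⟨f, u, hlt, hgt⟩ := geometric_hahn_banach_closed_point (convex_convexHull ℝ (Set.range a))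
    ((Set.finite_range a).isClosed_convexHull ℝ) hv
  have hf : ∀ (y : Fin n → ℝ) (t : ℝ),
      ∑ j, y j * (t * f (Pi.single j 1)) = t * f y := by
    intro y t
    have hy : f y = ∑ j, y j * f (Pi.single j 1) := by
      conv_lhs => rw [pi_eq_sum_univ' y]
      simp [map_sum, Pi.single]
    rw [hy, Finset.mul_sum]
    exact Finset.sum_congr rfl fun j _ => by ring
  obtain ⟨B, hB⟩ := (Set.finite_range b).bddAbove
  have hb : ∀ i, b i ≤ B := fun i => hB ⟨i, rfl⟩
  set t : ℝ := (|B - β| + 1) / (f v - u) with ht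
  have hpos : 0 < f v - u := sub_pos.2 hgt
  have ht0 : 0 ≤ t := by positivity
  have htv : t * (f v - u) = |B - β| + 1 := div_mul_cancel₀ _ hpos.ne'
  have key := h fun j => t * f (Pi.single j 1)
  simp only [hf] at key
  have hle : ⨆ i, (t * f (a i) + b i) ≤ t * u + B := ciSup_le fun i =>
    add_le_add (mul_le_mul_of_nonneg_left
      (hlt _ (subset_convexHull ℝ _ ⟨i, rfl⟩)).le ht0) (hb i)
  linarith [le_abs_self (B - β)]

/-- A term of a finite maximum of affine functions is bounded above by the maximum. -/
theorem affine_le_iSup {n m : ℕ} (a : Fin (m + 1) → Fin n → ℝ) (b : Fin (m + 1) → ℝ)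
    (x : Fin n → ℝ) (i : Fin (m + 1)) :
    (∑ j, a i j * x j) + b i ≤ ⨆ i, ((∑ j, a i j * x j) + b i) :=
  le_ciSup (f := fun i => (∑ j, a i j * x j) + b i) (Set.finite_range _).bddAbove i

/-- If the affine function `â·x + b̂` satisfies `â·x + b̂ + d(x) ≤ p(x)` for all
`x`, then `â ∈ C = { c : c + ãⱼ ∈ conv{a₁,…,a_{m_p}} ∀ j }`.  In particular,
every coefficient vector of a tropical polynomial quotient `q` of the division
of `p` by `d` lies in `C`. -/
theorem stmt9 {n mp md : ℕ}
    (a : Fin (mp + 1) → Fin n → ℝ) (b : Fin (mp + 1) → ℝ)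
    (ta : Fin (md + 1) → Fin n → ℝ) (tb : Fin (md + 1) → ℝ)
    (p d : (Fin n → ℝ) → ℝ)
    (hp : ∀ x, p x = ⨆ i, ((∑ j, a i j * x j) + b i))
    (hd : ∀ x, d x = ⨆ j, ((∑ k, ta j k * x k) + tb j))
    (C : Set (Fin n → ℝ))
    (hC : C = {c | ∀ j, c + ta j ∈ convexHull ℝ (Set.range a)}) :
    (∀ (ahat : Fin n → ℝ) (bhat : ℝ),
      (∀ x, (∑ j, ahat j * x j) + bhat + d x ≤ p x) → ahat ∈ C) ∧
    (∀ (mq : ℕ) (ahat : Fin (mq + 1) → Fin n → ℝ) (bhat : Fin (mq + 1) → ℝ)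
      (q : (Fin n → ℝ) → ℝ),
      (∀ x, q x = ⨆ i, ((∑ j, ahat i j * x j) + bhat i)) →
      (∀ x, d x + q x ≤ p x) →
      (∀ q' : (Fin n → ℝ) → ℝ, IsTropPoly q' → (∀ x, d x + q' x ≤ p x) →
        ∀ x, q' x ≤ q x) →
      ∀ i, ahat i ∈ C) := by
  have main : ∀ (ahat : Fin n → ℝ) (bhat : ℝ),
      (∀ x, (∑ j, ahat j * x j) + bhat + d x ≤ p x) → ahat ∈ C := by
    intro ahat bhat h
    rw [hC]
    intro j
    refine mem_convexHull_of_affine_le_iSup a b _ (bhat + tb j) fun x => ?_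
    have hx := h x
    rw [hp, hd] at hx
    have hj := affine_le_iSup ta tb x j
    simp only [Pi.add_apply, add_mul, Finset.sum_add_distrib]
    linarith
  refine ⟨main, fun mq ahat bhat q hq hle _ i => main (ahat i) (bhat i) fun x => ?_⟩
  have hi := affine_le_iSup ahat bhat x i
  rw [← hq] at hi
  linarith [hle x]
end

section
/- Let p₁, p₂ and d be tropical polynomial functions on ℝⁿ. Then for every x ∈ ℝⁿ, Q(p₁ + p₂, d)(x) ≥ Q(p₁, d)(x) + Q(p₂, d)(x) + d(x), where the inequality is in ℝ ∪ {−∞} (with the convention −∞ + t = −∞). -/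
open scoped BigOperators

theorem IsTropPoly.exists_affine_minorant_eq {n : ℕ} {d : (Fin n → ℝ) → ℝ} (hd : IsTropPoly d)
    (x : Fin n → ℝ) :
    ∃ (a : Fin n → ℝ) (b : ℝ), d x = (∑ j, a j * x j) + b ∧
      ∀ y, (∑ j, a j * y j) + b ≤ d y := by
  obtain ⟨m, a, b, h⟩ := hd
  obtain ⟨i, hi⟩ := exists_eq_ciSup_of_finite (f := fun i => (∑ j, a i j * x j) + b i)
  refine ⟨a i, b i, by rw [h, ← hi], fun y => ?_⟩
  rw [h]
  exact le_ciSup (f := fun i => (∑ j, a i j * y j) + b i) (Set.finite_range _).bddAbove i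

/-- `Q(p₁ + p₂, d)(x) ≥ Q(p₁, d)(x) + Q(p₂, d)(x) + d(x)` in `ℝ ∪ {-∞}`. -/
theorem stmt12 {n : ℕ} (p₁ p₂ d : (Fin n → ℝ) → ℝ)
    (hp₁ : IsTropPoly p₁) (hp₂ : IsTropPoly p₂) (hd : IsTropPoly d) :
    ∀ x, Qdiv p₁ d x + Qdiv p₂ d x + (d x : EReal) ≤
      Qdiv (fun y => p₁ y + p₂ y) d x := by
  intro x
  obtain ⟨a, b, hx, hle⟩ := hd.exists_affine_minorant_eq x
  rw [← EReal.le_sub_iff_add_le (.inl (EReal.coe_ne_bot _)) (.inl (EReal.coe_ne_top _))]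
  refine EReal.add_le_of_forall_lt fun u hu v hv => ?_
  obtain ⟨_, ⟨_, ⟨a₁, b₁, rfl, h₁⟩, rfl⟩, hu⟩ := lt_sSup_iff.mp hu
  obtain ⟨_, ⟨_, ⟨a₂, b₂, rfl, h₂⟩, rfl⟩, hv⟩ := lt_sSup_iff.mp hv
  refine (add_le_add hu.le hv.le).trans ?_
  rw [EReal.le_sub_iff_add_le (.inl (EReal.coe_ne_bot _)) (.inl (EReal.coe_ne_top _)),
    ← EReal.coe_add, ← EReal.coe_add]
  refine le_sSup ⟨_, ⟨a₁ + a₂ + a, b₁ + b₂ + b, ?_, fun y => ?_⟩, rfl⟩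
  · simp only [Pi.add_apply, add_mul, Finset.sum_add_distrib]
    linarith
  · simp only [Pi.add_apply, add_mul, Finset.sum_add_distrib]
    linarith [h₁ y, h₂ y, hle y]
end

section
/- Let A be an invertible n×n real matrix with columns a₁,…,a_n, and let â₁,…,â_m ∈ ℝⁿ. Define the zonotopes Z_p = { A μ : μ ∈ [0,1]ⁿ } and Z_q = { λ₁â₁ + ⋯ + λ_m â_m : λ ∈ [0,1]^m }. Then Z_q ⊆ Z_p if and only if A⁻¹ âᵢ ≥ 0 componentwise for every i = 1,…,m and A⁻¹ (â₁ + ⋯ + â_m) ≤ 1 componentwise (where 1 is the all-ones vector). -/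
open scoped BigOperators
open Matrix

/-- For invertible `A`, a vector lies in the zonotope spanned by the columns of `A` iff its
coordinates with respect to these columns lie in `[0, 1]`. -/
theorem exists_eq_mulVec_mem_Icc_iff {ι : Type*} [Fintype ι] [DecidableEq ι]
    {A : Matrix ι ι ℝ} (hA : IsUnit A.det) (y : ι → ℝ) :
    (∃ μ : ι → ℝ, (∀ k, μ k ∈ Set.Icc (0 : ℝ) 1) ∧ y = A *ᵥ μ) ↔
      ∀ k, (A⁻¹ *ᵥ y) k ∈ Set.Icc (0 : ℝ) 1 := by
  constructor
  · rintro ⟨μ, hμ, rfl⟩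
    simpa [mulVec_mulVec, nonsing_inv_mul A hA] using hμ
  · intro h
    exact ⟨A⁻¹ *ᵥ y, h, by simp [mulVec_mulVec, mul_nonsing_inv A hA]⟩

/-- For an invertible `n × n` matrix `A` and vectors `â₁,…,â_m`, the zonotope
`Z_q = { Σᵢ λᵢ âᵢ : λ ∈ [0,1]^m }` is contained in the zonotope
`Z_p = { A μ : μ ∈ [0,1]ⁿ }` iff `A⁻¹ âᵢ ≥ 0` componentwise for every `i` and
`A⁻¹ (â₁ + ⋯ + â_m) ≤ 1` componentwise. -/
theorem stmt18 {n m : ℕ} (A : Matrix (Fin n) (Fin n) ℝ) (hA : IsUnit A.det)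
    (ahat : Fin m → Fin n → ℝ)
    (Zp Zq : Set (Fin n → ℝ))
    (hZp : Zp = {y | ∃ μ : Fin n → ℝ, (∀ k, μ k ∈ Set.Icc (0 : ℝ) 1) ∧ y = A *ᵥ μ})
    (hZq : Zq = {y | ∃ lam : Fin m → ℝ, (∀ i, lam i ∈ Set.Icc (0 : ℝ) 1) ∧
      y = ∑ i, lam i • ahat i}) :
    Zq ⊆ Zp ↔
      (∀ i k, 0 ≤ (A⁻¹ *ᵥ ahat i) k) ∧ (∀ k, (A⁻¹ *ᵥ ∑ i, ahat i) k ≤ 1) := by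
  have mulVec_sum_smul (lam : Fin m → ℝ) (k : Fin n) :
      (A⁻¹ *ᵥ ∑ i, lam i • ahat i) k = ∑ i, lam i * (A⁻¹ *ᵥ ahat i) k := by
    simp [mulVec_sum, mulVec_smul]
  subst hZp hZq
  simp only [Set.ofPred_subset_ofPred, exists_eq_mulVec_mem_Icc_iff hA]
  constructor
  · intro h
    refine ⟨fun i k => ?_, fun k => ?_⟩
    · refine (h (ahat i) ⟨Pi.single i 1, fun j => ?_, ?_⟩ k).1
      · rcases eq_or_ne j i with rfl | hj <;> simp [*]
      · simp [Pi.single_apply]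
    · exact (h (∑ i, ahat i) ⟨1, by simp, by simp⟩ k).2
  · rintro ⟨hnonneg, hle⟩ y ⟨lam, hlam, rfl⟩ k
    rw [mulVec_sum_smul]
    refine ⟨Finset.sum_nonneg fun i _ => mul_nonneg (hlam i).1 (hnonneg i k), ?_⟩
    calc ∑ i, lam i * (A⁻¹ *ᵥ ahat i) k ≤ ∑ i, (A⁻¹ *ᵥ ahat i) k :=
          Finset.sum_le_sum fun i _ => mul_le_of_le_one_left (hnonneg i k) (hlam i).2
      _ ≤ 1 := by simpa [mulVec_sum] using hle k
end

section
/- Let A be an invertible n×n real matrix with columns a₁,…,a_n and let B = (b₁,…,b_n)ᵀ ∈ ℝⁿ; define p(x) = Σ_{i=1}^{n} max(aᵢ·x + bᵢ, 0). Let â₁,…,â_m ∈ ℝⁿ and b̂₁,…,b̂_m ∈ ℝ and define q(x) = Σ_{i=1}^{m} max(âᵢ·x + b̂ᵢ, 0). Then q(x) ≤ p(x) for all x ∈ ℝⁿ if and only if the following three conditions hold: (1) A⁻¹ âᵢ ≥ 0 componentwise for all i = 1,…,m; (2) A⁻¹ (Σ_{i=1}^{m} âᵢ) ≤ 1 componentwise;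 and (3) b̂ᵢ ≤ Bᵀ A⁻¹ âᵢ for all i = 1,…,m. -/
open scoped BigOperators
open Matrix

/-- A sum of ReLU terms is bounded by `∑ k, max (y k) 0` iff its weights are nonnegative, sum to
at most one in each coordinate, and its biases are nonpositive. -/
theorem sum_relu_le_sum_posPart_iff {ι κ : Type*} [Fintype ι] [Fintype κ]
    (c : ι → κ → ℝ) (d : ι → ℝ) :
    (∀ y : κ → ℝ, ∑ i, max (c i ⬝ᵥ y + d i) 0 ≤ ∑ k, max (y k) 0) ↔
      (∀ i k, 0 ≤ c i k) ∧ (∀ k, ∑ i, c i k ≤ 1) ∧ ∀ i, d i ≤ 0 := by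
  classical
  constructor
  · intro h
    have hle : ∀ (y : κ → ℝ) i, c i ⬝ᵥ y + d i ≤ ∑ k, max (y k) 0 := fun y i =>
      (le_max_left _ 0).trans <| (Finset.single_le_sum
        (f := fun i => max (c i ⬝ᵥ y + d i) 0) (fun _ _ => le_max_right _ _)
        (Finset.mem_univ i)).trans (h y)
    have hd : ∀ i, d i ≤ 0 := fun i => by simpa using hle 0 i
    refine ⟨fun i k => ?_, fun k => ?_, hd⟩
    · by_contra! hc
      have ht : 0 ≤ (1 - d i) / -c i k := div_nonneg (by linarith [hd i]) (by linarith)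
      have key := hle (Pi.single k (-((1 - d i) / -c i k))) i
      have hz : ∑ j, max ((Pi.single k (-((1 - d i) / -c i k)) : κ → ℝ) j) 0 = 0 := by
        refine Finset.sum_eq_zero fun j _ => max_eq_right ?_
        rcases eq_or_ne j k with rfl | hj
        · simpa using ht
        · simp [hj]
      rw [hz, dotProduct_single] at key
      have : c i k * -((1 - d i) / -c i k) = 1 - d i := by
        field_simp [hc.ne]
      linarith
    · by_contra! hc
      have hD : ∑ i, d i ≤ 0 := Finset.sum_nonpos fun i _ => hd i
      have hs : 0 < ∑ i, c i k - 1 := by linarith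
      obtain ⟨t, ht⟩ : ∃ t, t = (1 - ∑ i, d i) / (∑ i, c i k - 1) := ⟨_, rfl⟩
      have ht0 : 0 ≤ t := ht ▸ div_nonneg (by linarith) hs.le
      have hz : ∑ j, max ((Pi.single k t : κ → ℝ) j) 0 = t := by
        rw [Finset.sum_eq_single k (fun j _ hj => by simp [hj]) (by simp)]
        simpa using ht0
      have key := (Finset.sum_le_sum fun i _ => le_max_left _ _).trans (h (Pi.single k t))
      simp only [hz, dotProduct_single, Finset.sum_add_distrib, ← Finset.sum_mul] at key
      rw [eq_div_iff hs.ne'] at ht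
      linarith
  · rintro ⟨hc, hs, hd⟩ y
    calc ∑ i, max (c i ⬝ᵥ y + d i) 0 ≤ ∑ i, ∑ k, c i k * max (y k) 0 := by
          refine Finset.sum_le_sum fun i _ => max_le ?_ ?_
          · have : c i ⬝ᵥ y ≤ ∑ k, c i k * max (y k) 0 := Finset.sum_le_sum fun k _ =>
              mul_le_mul_of_nonneg_left (le_max_left _ _) (hc i k)
            linarith [hd i]
          · exact Finset.sum_nonneg fun k _ => mul_nonneg (hc i k) (le_max_right _ _)
      _ = ∑ k, (∑ i, c i k) * max (y k) 0 := by
          rw [Finset.sum_comm]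
          simp only [Finset.sum_mul]
      _ ≤ ∑ k, max (y k) 0 := Finset.sum_le_sum fun k _ =>
          mul_le_of_le_one_left (le_max_right _ _) (hs k)

/-- Let `p(x) = Σᵢ max(aᵢ·x + bᵢ, 0)` where `a₁,…,a_n` are the columns of an
invertible matrix `A` and `B = (b₁,…,b_n)`, and let
`q(x) = Σᵢ max(âᵢ·x + b̂ᵢ, 0)`.  Then `q ≤ p` pointwise iff
(1) `A⁻¹ âᵢ ≥ 0` componentwise for all `i`,
(2) `A⁻¹ (Σᵢ âᵢ) ≤ 1` componentwise, and
(3) `b̂ᵢ ≤ Bᵀ A⁻¹ âᵢ` for all `i`. -/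
theorem stmt19 {n m : ℕ} (A : Matrix (Fin n) (Fin n) ℝ) (hA : IsUnit A.det)
    (B : Fin n → ℝ)
    (ahat : Fin m → Fin n → ℝ) (bhat : Fin m → ℝ)
    (p q : (Fin n → ℝ) → ℝ)
    (hp : ∀ x, p x = ∑ i, max ((∑ j, A j i * x j) + B i) 0)
    (hq : ∀ x, q x = ∑ i, max ((∑ j, ahat i j * x j) + bhat i) 0) :
    (∀ x, q x ≤ p x) ↔
      ((∀ i k, 0 ≤ (A⁻¹ *ᵥ ahat i) k) ∧
       (∀ k, (A⁻¹ *ᵥ ∑ i, ahat i) k ≤ 1) ∧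
       (∀ i, bhat i ≤ B ⬝ᵥ (A⁻¹ *ᵥ ahat i))) := by
  have hpx : ∀ x, p x = ∑ k, max ((x ᵥ* A + B) k) 0 := fun x => by
    simp [hp, vecMul, dotProduct, mul_comm]
  have hqx : ∀ x, q x = ∑ i, max ((A⁻¹ *ᵥ ahat i) ⬝ᵥ (x ᵥ* A + B) +
      (bhat i - B ⬝ᵥ (A⁻¹ *ᵥ ahat i))) 0 := fun x => by
    rw [hq]
    refine Finset.sum_congr rfl fun i _ => ?_
    have hx : (A⁻¹ *ᵥ ahat i) ⬝ᵥ (x ᵥ* A) = ∑ j, ahat i j * x j := by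
      rw [dotProduct_comm, ← dotProduct_mulVec, mulVec_mulVec, mul_nonsing_inv A hA, one_mulVec,
        dotProduct_comm, dotProduct]
    rw [dotProduct_add, hx, dotProduct_comm _ B]
    congr 1
    ring
  have hsurj : Function.Surjective fun x => x ᵥ* A + B := fun y =>
    ⟨(y - B) ᵥ* A⁻¹, by simp [vecMul_vecMul, nonsing_inv_mul A hA]⟩
  have hsum : ∀ k, (A⁻¹ *ᵥ ∑ i, ahat i) k = ∑ i, (A⁻¹ *ᵥ ahat i) k := fun k => by
    rw [mulVec_sum, Finset.sum_apply]
  simp only [hpx, hqx, hsum]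
  rw [← hsurj.forall (p := fun y => ∑ i, max ((A⁻¹ *ᵥ ahat i) ⬝ᵥ y +
      (bhat i - B ⬝ᵥ (A⁻¹ *ᵥ ahat i))) 0 ≤ ∑ k, max (y k) 0),
    sum_relu_le_sum_posPart_iff]
  simp only [sub_nonpos]
end
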